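/- arXiv:2205.14720 — 4 statements merged into one kernel-verified Lean document; each statement's English description precedes it below -/
import Mathlib

section
/- Let ι be a finite index set, let L_i (i ∈ ι) be Lie algebras over ℝ, and let L = Π_{i ∈ ι} L_i be their product Lie algebra. Let p be a Lie triple system in L which is irreducible in the sense that every ℝ-submodule q ⊆ p satisfying ⁅⁅x,y⁆,z⁆ ∈ q for all x, y ∈ p and z ∈ q is either 0 or p. Then there exists a subset I ⊆ ι such that for every nonzero x ∈ p and every i ∈ ι, the i-th component of x is nonzero if and only if i ∈ I. -/
/-- The product of a family of Lie rings, with componentwise bracket. -/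
instance Pi.instLieRing {ι : Type*} {L : ι → Type*} [∀ i, LieRing (L i)] :
    LieRing (∀ i, L i) :=
  { Pi.addCommGroup with
    bracket := fun x y => fun i => ⁅x i, y i⁆
    add_lie := fun x y z => funext fun i => add_lie (x i) (y i) (z i)
    lie_add := fun x y z => funext fun i => lie_add (x i) (y i) (z i)
    lie_self := fun x => funext fun i => lie_self (x i)
    leibniz_lie := fun x y z => funext fun i => leibniz_lie (x i) (y i) (z i) }

/-- The product of a family of real Lie algebras. -/
instance Pi.instLieAlgebra {ι : Type*} {L : ι → Type*} [∀ i, LieRing (L i)]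
    [∀ i, LieAlgebra ℝ (L i)] : LieAlgebra ℝ (∀ i, L i) :=
  { Pi.module ι L ℝ with
    lie_smul := fun t x y => funext fun i => lie_smul t (x i) (y i) }

/-- An irreducible Lie triple system `p` in a finite product of real
Lie algebras is `k`-diagonal: there is a set `I` of indices such that every nonzero
element of `p` has nonzero `i`-th component exactly when `i ∈ I`. -/
theorem irreducible_lieTripleSystem_is_diagonal {ι : Type*} [Finite ι]
    {L : ι → Type*} [∀ i, LieRing (L i)] [∀ i, LieAlgebra ℝ (L i)]
    (p : Submodule ℝ (∀ i, L i))
    (hp : ∀ x ∈ p, ∀ y ∈ p, ∀ z ∈ p, ⁅⁅x, y⁆, z⁆ ∈ p)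
    (hirr : ∀ q : Submodule ℝ (∀ i, L i), q ≤ p →
      (∀ x ∈ p, ∀ y ∈ p, ∀ z ∈ q, ⁅⁅x, y⁆, z⁆ ∈ q) → q = ⊥ ∨ q = p) :
    ∃ I : Set ι, ∀ x ∈ p, x ≠ 0 → ∀ i : ι, x i ≠ 0 ↔ i ∈ I := by
  refine ⟨{i | ∃ x ∈ p, x i ≠ 0}, fun x hx hx0 i => ⟨fun h => ⟨x, hx, h⟩, ?_⟩⟩
  rintro ⟨y, hy, hyi⟩ hxi
  let q : Submodule ℝ (∀ i, L i) := p ⊓ LinearMap.ker (LinearMap.proj i)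
  have hq (z : ∀ i, L i) : z ∈ q ↔ z ∈ p ∧ z i = 0 := Iff.rfl
  have hstable : ∀ x ∈ p, ∀ y ∈ p, ∀ z ∈ q, ⁅⁅x, y⁆, z⁆ ∈ q := by
    intro a ha b hb z hz
    rw [hq] at hz ⊢
    refine ⟨hp a ha b hb z hz.1, ?_⟩
    change ⁅⁅a, b⁆ i, z i⁆ = 0
    rw [hz.2, lie_zero]
  rcases hirr q inf_le_left hstable with hbot | htop
  · have hxq : x ∈ q := (hq x).2 ⟨hx, hxi⟩
    rw [hbot, Submodule.mem_bot] at hxq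
    exact hx0 hxq
  · exact hyi ((hq y).1 (htop ▸ hy)).2
end

section
/- Let L be a Lie algebra over ℝ and let p ⊆ L be an ℝ-submodule such that ⁅⁅X,Y⁆,Y⁆ ≠ 0 for every pair of linearly independent elements X, Y ∈ p. Suppose q₁, q₂ ⊆ p are ℝ-submodules with ⁅x,y⁆ = 0 for all x ∈ q₁ and y ∈ q₂, and suppose q₁ has dimension at least 2 over ℝ. Then q₂ = 0. -/
/-- In a real Lie algebra, let `p` be a submodule on which
`⁅⁅X,Y⁆,Y⁆ ≠ 0` for every pair of linearly independent `X, Y ∈ p` (nonvanishing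
sectional curvature). If `q₁, q₂ ⊆ p` are commuting submodules and `q₁` has
dimension at least `2`, then `q₂ = 0`. -/
theorem commuting_submodules_of_nonvanishing_curvature {L : Type*}
    [LieRing L] [LieAlgebra ℝ L] (p : Submodule ℝ L)
    (hcurv : ∀ X ∈ p, ∀ Y ∈ p, LinearIndependent ℝ ![X, Y] → ⁅⁅X, Y⁆, Y⁆ ≠ 0)
    (q₁ q₂ : Submodule ℝ L) (hq₁ : q₁ ≤ p) (hq₂ : q₂ ≤ p)
    (hcomm : ∀ x ∈ q₁, ∀ y ∈ q₂, ⁅x, y⁆ = 0)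
    (hdim : 2 ≤ Module.rank ℝ q₁) :
    q₂ = ⊥ := by
  refine (Submodule.eq_bot_iff _).2 fun y hy => ?_
  by_contra hy0
  have hspan : q₁ ≤ Submodule.span ℝ {y} := by
    intro x hx
    by_contra hxy
    refine hcurv x (hq₁ hx) y (hq₂ hy) ?_ (by rw [hcomm x hx y hy, zero_lie])
    rw [LinearIndependent.pair_symm_iff, LinearIndependent.pair_iff' hy0]
    exact fun a ha => hxy (Submodule.mem_span_singleton.2 ⟨a, ha⟩)
  have hrank : Module.rank ℝ q₁ ≤ 1 :=
    (Submodule.rank_mono hspan).trans ((rank_span_le _).trans (Cardinal.mk_singleton y).le)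
  exact absurd (hdim.trans hrank) (not_le.2 Cardinal.one_lt_two)
end

section
/- Let k, n be natural numbers, let i, j ∈ Fin k with i ≠ j, and let S_i, S_j ⊆ Fin n be disjoint sets. Let X, Y be k×n complex matrices such that X(a,c) = 0 unless a = i and c ∈ S_i, and Y(a,c) = 0 unless a = j and c ∈ S_j. Form the (k+n)×(k+n) complex block matrices A = [[0, X],[−X*, 0]] and B = [[0, Y],[−Y*, 0]], where X* denotes the conjugate transpose. Then A·B = 0 and B·A = 0; in particular the commutator ⁅A,B⁆ = A·B − B·A vanishes. -/
open scoped Matrix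

/-- Matrices with no common nonzero column satisfy `X * Yᴴ = 0`. -/
theorem Matrix.mul_conjTranspose_eq_zero_of_columns {l m n R : Type*} [Fintype n]
    [NonUnitalSemiring R] [StarRing R] {X : Matrix l n R} {Y : Matrix m n R}
    (h : ∀ a b c, X a c = 0 ∨ Y b c = 0) : X * Yᴴ = 0 := by
  ext a b
  refine Finset.sum_eq_zero fun c _ => ?_
  rcases h a b c with h | h <;> simp [h]

/-- Matrices with no common nonzero row satisfy `Xᴴ * Y = 0`. -/
theorem Matrix.conjTranspose_mul_eq_zero_of_rows {l m n R : Type*} [Fintype n]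
    [NonUnitalSemiring R] [StarRing R] {X : Matrix n l R} {Y : Matrix n m R}
    (h : ∀ a b c, X c a = 0 ∨ Y c b = 0) : Xᴴ * Y = 0 := by
  ext a b
  refine Finset.sum_eq_zero fun c _ => ?_
  rcases h a b c with h | h <;> simp [h]

/-- The product of `[[0, X], [-Xᴴ, 0]]` and `[[0, Y], [-Yᴴ, 0]]` vanishes when
`X * Yᴴ = 0` and `Xᴴ * Y = 0`. -/
theorem Matrix.fromBlocks_neg_conjTranspose_mul_eq_zero {m n R : Type*} [Fintype m] [Fintype n]
    [NonUnitalRing R] [StarRing R] {X Y : Matrix m n R} (h₁ : X * Yᴴ = 0) (h₂ : Xᴴ * Y = 0) :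
    fromBlocks 0 X (-Xᴴ) 0 * fromBlocks 0 Y (-Yᴴ) 0 = 0 := by
  simp [fromBlocks_multiply, h₁, h₂]

/-- block matrices `A = [[0,X],[-X*,0]]`, `B = [[0,Y],[-Y*,0]]` built
from matrices `X, Y` supported on distinct rows `i ≠ j` and disjoint column sets
satisfy `A·B = 0`, `B·A = 0`, and hence `⁅A, B⁆ = 0`. -/
theorem blocks_commute_of_disjoint_support {k n : ℕ} (i j : Fin k) (hij : i ≠ j)
    (Si Sj : Set (Fin n)) (hdisj : Disjoint Si Sj)
    (X Y : Matrix (Fin k) (Fin n) ℂ)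
    (hX : ∀ (a : Fin k) (c : Fin n), ¬(a = i ∧ c ∈ Si) → X a c = 0)
    (hY : ∀ (a : Fin k) (c : Fin n), ¬(a = j ∧ c ∈ Sj) → Y a c = 0)
    (A B : Matrix (Fin k ⊕ Fin n) (Fin k ⊕ Fin n) ℂ)
    (hA : A = Matrix.fromBlocks 0 X (-Xᴴ) 0)
    (hB : B = Matrix.fromBlocks 0 Y (-Yᴴ) 0) :
    A * B = 0 ∧ B * A = 0 ∧ ⁅A, B⁆ = 0 := by
  have hcol : ∀ a b c, X a c = 0 ∨ Y b c = 0 := by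
    intro a b c
    by_cases hc : c ∈ Si
    · exact Or.inr (hY b c fun h => Set.disjoint_left.mp hdisj hc h.2)
    · exact Or.inl (hX a c fun h => hc h.2)
  have hrow : ∀ a b c, X c a = 0 ∨ Y c b = 0 := by
    intro a b c
    by_cases hc : c = i
    · exact Or.inr (hY c b fun h => hij (hc.symm.trans h.1))
    · exact Or.inl (hX c a fun h => hc h.1)
  have hAB : A * B = 0 := by
    rw [hA, hB]
    exact Matrix.fromBlocks_neg_conjTranspose_mul_eq_zero
      (Matrix.mul_conjTranspose_eq_zero_of_columns hcol)
      (Matrix.conjTranspose_mul_eq_zero_of_rows hrow)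
  have hBA : B * A = 0 := by
    rw [hA, hB]
    exact Matrix.fromBlocks_neg_conjTranspose_mul_eq_zero
      (Matrix.mul_conjTranspose_eq_zero_of_columns fun a b c => (hcol b a c).symm)
      (Matrix.conjTranspose_mul_eq_zero_of_rows fun a b c => (hrow b a c).symm)
  exact ⟨hAB, hBA, by rw [Ring.lie_def, hAB, hBA, sub_zero]⟩
end

section
/- Let k, n be natural numbers, let i ∈ Fin k, and let S ⊆ Fin n. Let X, Y, Z be k×n complex matrices each satisfying M(a,c) = 0 unless a = i and c ∈ S. Form the (k+n)×(k+n) complex block matrices A = [[0, X],[−X*, 0]], B = [[0, Y],[−Y*, 0]], C = [[0, Z],[−Z*, 0]], where M* denotes conjugate transpose, and let ⁅·,·⁆ denote the matrix commutator. Then there exists a k×n complex matrix W with W(a,c) = 0 unless a = i and c ∈ S such that ⁅⁅A,B⁆,C⁆ = [[0, W],[−W*, 0]]. Explicitly, W = (Y X* − X Y*)·Z − Z·(Y* X − X* Y). -/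
open scoped Matrix

/-- A triple product `U * Vᴴ * Z` vanishes outside the rows where `U` is supported and the
columns where `Z` is supported. -/
theorem Matrix.mul_conjTranspose_mul_apply_eq_zero {m n R : Type*} [Fintype m] [Fintype n]
    [Semiring R] [StarRing R] {r : m → Prop} {s : n → Prop} {U Z : Matrix m n R}
    (V : Matrix m n R) (hU : ∀ a c, ¬(r a ∧ s c) → U a c = 0)
    (hZ : ∀ a c, ¬(r a ∧ s c) → Z a c = 0) {a : m} {c : n} (h : ¬(r a ∧ s c)) :
    (U * Vᴴ * Z) a c = 0 := by
  by_cases ha : r a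
  · rw [Matrix.mul_apply]
    refine Finset.sum_eq_zero fun b _ => ?_
    rw [hZ b c fun hb => h ⟨ha, hb.2⟩, mul_zero]
  · rw [Matrix.mul_assoc, Matrix.mul_apply]
    refine Finset.sum_eq_zero fun b _ => ?_
    rw [hU a b fun hb => ha hb.1, zero_mul]

/-- The double bracket of block off-diagonal skew-Hermitian matrices is again block
off-diagonal and skew-Hermitian. -/
theorem Matrix.lie_lie_fromBlocks_neg_conjTranspose {m n R : Type*} [Fintype m] [Fintype n]
    [Ring R] [StarRing R] (X Y Z W : Matrix m n R)
    (hW : W = (Y * Xᴴ - X * Yᴴ) * Z - Z * (Yᴴ * X - Xᴴ * Y)) :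
    ⁅⁅fromBlocks 0 X (-Xᴴ) 0, fromBlocks 0 Y (-Yᴴ) 0⁆, fromBlocks 0 Z (-Zᴴ) 0⁆ =
      fromBlocks 0 W (-Wᴴ) 0 := by
  subst hW
  simp only [Ring.lie_def, fromBlocks_multiply, sub_eq_add_neg, fromBlocks_neg, fromBlocks_add,
    conjTranspose_add, conjTranspose_neg, conjTranspose_mul, conjTranspose_conjTranspose]
  congr 1 <;> simp only [Matrix.mul_zero, Matrix.zero_mul, Matrix.mul_neg, Matrix.neg_mul,
    Matrix.mul_add, Matrix.add_mul, Matrix.mul_assoc, neg_zero, add_zero, zero_add, neg_add,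
    neg_neg] <;> abel

/-- for matrices `X, Y, Z` supported on row `i` and column set `S`,
the double bracket `⁅⁅A,B⁆,C⁆` of the block matrices `A = [[0,X],[-X*,0]]`, etc.,
is again of the form `[[0,W],[-W*,0]]` with `W = (Y X* - X Y*) Z - Z (Y* X - X* Y)`
supported on row `i` and column set `S`. -/
theorem doubleBracket_block_form {k n : ℕ} (i : Fin k) (S : Set (Fin n))
    (X Y Z : Matrix (Fin k) (Fin n) ℂ)
    (hX : ∀ (a : Fin k) (c : Fin n), ¬(a = i ∧ c ∈ S) → X a c = 0)
    (hY : ∀ (a : Fin k) (c : Fin n), ¬(a = i ∧ c ∈ S) → Y a c = 0)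
    (hZ : ∀ (a : Fin k) (c : Fin n), ¬(a = i ∧ c ∈ S) → Z a c = 0)
    (A B C : Matrix (Fin k ⊕ Fin n) (Fin k ⊕ Fin n) ℂ)
    (hA : A = Matrix.fromBlocks 0 X (-Xᴴ) 0)
    (hB : B = Matrix.fromBlocks 0 Y (-Yᴴ) 0)
    (hC : C = Matrix.fromBlocks 0 Z (-Zᴴ) 0) :
    ∃ W : Matrix (Fin k) (Fin n) ℂ,
      (∀ (a : Fin k) (c : Fin n), ¬(a = i ∧ c ∈ S) → W a c = 0) ∧
      ⁅⁅A, B⁆, C⁆ = Matrix.fromBlocks 0 W (-Wᴴ) 0 ∧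
      W = (Y * Xᴴ - X * Yᴴ) * Z - Z * (Yᴴ * X - Xᴴ * Y) := by
  subst hA hB hC
  refine ⟨_, fun a c h => ?_, Matrix.lie_lie_fromBlocks_neg_conjTranspose X Y Z _ rfl, rfl⟩
  have key {U V T : Matrix (Fin k) (Fin n) ℂ}
      (hU : ∀ a c, ¬(a = i ∧ c ∈ S) → U a c = 0) (hT : ∀ a c, ¬(a = i ∧ c ∈ S) → T a c = 0) :
      (U * Vᴴ * T) a c = 0 :=
    Matrix.mul_conjTranspose_mul_apply_eq_zero (r := (· = i)) (s := (· ∈ S)) V hU hT h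
  simp only [Matrix.sub_mul, Matrix.mul_sub, ← Matrix.mul_assoc, Matrix.sub_apply,
    key hY hZ, key hX hZ, key hZ hX, key hZ hY, sub_zero]
end
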